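/- arXiv:math/0404060 — 2 statements merged into one kernel-verified Lean document; each statement's English description precedes it below -/
import Mathlib

section
/- With V = ℝ^{2m̄}, Ψᵢ as the rank-2 diagonal symmetric forms (Ψᵢ(eᵢ,eᵢ)=Ψᵢ(fᵢ,fᵢ)=1, all other components zero), Ψ_{1,i} the symmetric trilinear forms with Ψ_{1,i}(eᵢ,eᵢ,eᵢ)=Ψ_{1,i}(fᵢ,fᵢ,fᵢ)=1 and all other components zero, and A₁ = Σᵢ A_{1,Ψᵢ,Ψ_{1,i}}, ξ₁ = Σᵢeᵢ, ξ₂ = Σᵢfᵢ, ξ₃ = ξ₁+ξ₂: the operator R_{A₁}(ξ₁,ξ₂,ξ₃) satisfies R_{A₁}(ξ₁,ξ₂,ξ₃)eᵢ = −2fᵢ and R_{A₁}(ξ₁,ξ₂,ξ₃)fᵢ = 2eᵢ, and hence has rank 2m̄. -/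
open scoped RealInnerProductSpace BigOperators

/-- On ℝ^{2mb}, with A₁ = Σᵢ A_{1,Ψᵢ,Ψ_{1,i}}, ξ₁ = Σeᵢ,
ξ₂ = Σfᵢ, ξ₃ = ξ₁+ξ₂, the operator R_{A₁}(ξ₁,ξ₂,ξ₃) maps eᵢ ↦ −2fᵢ,
fᵢ ↦ 2eᵢ and hence is invertible (has rank 2mb). -/
theorem stmt11 (mb : ℕ)
    (e f : Fin mb → EuclideanSpace ℝ (Fin mb ⊕ Fin mb))
    (he : ∀ i, e i = EuclideanSpace.single (Sum.inl i) 1)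
    (hf : ∀ i, f i = EuclideanSpace.single (Sum.inr i) 1)
    (Ψ : Fin mb → EuclideanSpace ℝ (Fin mb ⊕ Fin mb) →
          EuclideanSpace ℝ (Fin mb ⊕ Fin mb) → ℝ)
    (hΨ : ∀ i x y, Ψ i x y =
      x (Sum.inl i) * y (Sum.inl i) + x (Sum.inr i) * y (Sum.inr i))
    (Ψ₁ : Fin mb → EuclideanSpace ℝ (Fin mb ⊕ Fin mb) →
          EuclideanSpace ℝ (Fin mb ⊕ Fin mb) →
          EuclideanSpace ℝ (Fin mb ⊕ Fin mb) → ℝ)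
    (hΨ₁ : ∀ i x y z, Ψ₁ i x y z =
      x (Sum.inl i) * y (Sum.inl i) * z (Sum.inl i)
        + x (Sum.inr i) * y (Sum.inr i) * z (Sum.inr i))
    (A₁ : EuclideanSpace ℝ (Fin mb ⊕ Fin mb) → EuclideanSpace ℝ (Fin mb ⊕ Fin mb) →
          EuclideanSpace ℝ (Fin mb ⊕ Fin mb) → EuclideanSpace ℝ (Fin mb ⊕ Fin mb) →
          EuclideanSpace ℝ (Fin mb ⊕ Fin mb) → ℝ)
    (hA₁ : ∀ x y z w v, A₁ x y z w v =
      ∑ i, (Ψ₁ i x w v * Ψ i y z + Ψ i x w * Ψ₁ i y z v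
        - Ψ₁ i x z v * Ψ i y w - Ψ i x z * Ψ₁ i y w v))
    (ξ₁ ξ₂ ξ₃ : EuclideanSpace ℝ (Fin mb ⊕ Fin mb))
    (hξ₁ : ξ₁ = ∑ i, e i) (hξ₂ : ξ₂ = ∑ i, f i) (hξ₃ : ξ₃ = ξ₁ + ξ₂)
    (R : EuclideanSpace ℝ (Fin mb ⊕ Fin mb) →ₗ[ℝ] EuclideanSpace ℝ (Fin mb ⊕ Fin mb))
    (hR : ∀ z w, ⟪R z, w⟫ = A₁ ξ₁ ξ₂ z w ξ₃) :
    (∀ i, R (e i) = (-2 : ℝ) • f i) ∧ (∀ i, R (f i) = (2 : ℝ) • e i) ∧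
      Function.Bijective R := by
  have a1 : ∀ i, ξ₁ (Sum.inl i) = 1 := by
    intro i; simp [hξ₁, he, Pi.single_apply]
  have a2 : ∀ i, ξ₁ (Sum.inr i) = 0 := by
    intro i; simp [hξ₁, he]
  have b1 : ∀ i, ξ₂ (Sum.inl i) = 0 := by
    intro i; simp [hξ₂, hf]
  have b2 : ∀ i, ξ₂ (Sum.inr i) = 1 := by
    intro i; simp [hξ₂, hf, Pi.single_apply]
  have c1 : ∀ i, ξ₃ (Sum.inl i) = 1 := by
    intro i; simp [hξ₃, a1, b1]
  have c2 : ∀ i, ξ₃ (Sum.inr i) = 1 := by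
    intro i; simp [hξ₃, a2, b2]
  have key : ∀ z w, ⟪R z, w⟫ = ∑ i, (2 * z (Sum.inr i) * w (Sum.inl i)
      - 2 * z (Sum.inl i) * w (Sum.inr i)) := by
    intro z w
    rw [hR, hA₁]
    refine Finset.sum_congr rfl fun i _ => ?_
    simp only [hΨ, hΨ₁, a1, a2, b1, b2, c1, c2]
    ring
  have kl : ∀ z i, R z (Sum.inl i) = 2 * z (Sum.inr i) := by
    intro z i
    have h := key z (EuclideanSpace.single (Sum.inl i) 1)
    simpa [EuclideanSpace.inner_single_right, Pi.single_apply] using h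
  have kr : ∀ z i, R z (Sum.inr i) = -2 * z (Sum.inl i) := by
    intro z i
    have h := key z (EuclideanSpace.single (Sum.inr i) 1)
    simpa [EuclideanSpace.inner_single_right, Pi.single_apply] using h
  have inj : Function.Injective R := by
    intro x y hxy
    ext k
    rcases k with k | k
    · have h1 := kr x k
      have h2 := kr y k
      rw [hxy] at h1
      linarith
    · have h1 := kl x k
      have h2 := kl y k
      rw [hxy] at h1
      linarith
  refine ⟨fun i => ?_, fun i => ?_, inj, LinearMap.injective_iff_surjective.mp inj⟩
  · ext k
    rcases k with k | k
    · rw [kl]; simp [he, hf]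
    · rw [kr]; simp [he, hf]; split_ifs <;> simp
  · ext k
    rcases k with k | k
    · rw [kl]; simp [he, hf, Pi.single_apply]
    · rw [kr]; simp [he, hf]
end

section
/- For a vector space V of dimension m = 2m̄ or 2m̄+1, there exists an algebraic covariant derivative curvature tensor A₁ on V such that any representation A₁ = Σ_{j=1}^{ν₁} λⱼ A_{1,Φⱼ,Φ_{1,j}} requires ν₁ ≥ m̄. In particular ν₁(m) ≥ m/2. -/
open scoped BigOperators

namespace S13

abbrev Bil (V : Type*) [AddCommGroup V] [Module ℝ V] := V →ₗ[ℝ] V →ₗ[ℝ] ℝ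
abbrev Tri (V : Type*) [AddCommGroup V] [Module ℝ V] := V →ₗ[ℝ] V →ₗ[ℝ] V →ₗ[ℝ] ℝ

/-- A pair of a symmetric bilinear and a symmetric trilinear form. -/
structure P (V : Type*) [AddCommGroup V] [Module ℝ V] where
  f : Bil V
  g : Tri V
  hf : ∀ x y, f x y = f y x
  hg1 : ∀ x y z, g x y z = g y x z
  hg2 : ∀ x y z, g x y z = g x z y

section
variable {V : Type*} [AddCommGroup V] [Module ℝ V]

/-- The tensor of a pair. -/
def K (p : P V) : V → V → V → V → V → ℝ := fun x y z w v =>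
  p.g x w v * p.f y z + p.f x w * p.g y z v - p.g x z v * p.f y w - p.f x z * p.g y w v

def R (k : ℕ) (A : V → V → V → V → V → ℝ) : Prop := ∃ τ : Fin k → P V, A = ∑ i, K (τ i)

def smulP (c : ℝ) (p : P V) : P V where
  f := c • p.f
  g := p.g
  hf x y := by simp [p.hf x y]
  hg1 := p.hg1
  hg2 := p.hg2

lemma K_smul (c : ℝ) (p : P V) (x y z w v : V) : K (smulP c p) x y z w v = c * K p x y z w v := by
  simp [K, smulP]; ring

def zeroP : P V where
  f := 0
  g := 0
  hf x y := by simp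
  hg1 x y z := by simp
  hg2 x y z := by simp

lemma R_succ {k : ℕ} {A : V → V → V → V → V → ℝ} :
    R (k+1) A ↔ ∃ B p, R k B ∧ A = B + K p := by
  constructor
  · rintro ⟨τ, rfl⟩
    exact ⟨_, τ (Fin.last k), ⟨fun i => τ i.castSucc, rfl⟩, Fin.sum_univ_castSucc _⟩
  · rintro ⟨B, p, ⟨τ, rfl⟩, rfl⟩
    refine ⟨Fin.snoc τ p, ?_⟩
    rw [Fin.sum_univ_castSucc]; simp

lemma R_mono {k l : ℕ} (h : k ≤ l) {A : V → V → V → V → V → ℝ} (hA : R k A) : R l A := by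
  induction h with
  | refl => exact hA
  | step _ ih =>
    refine R_succ.2 ⟨A, zeroP, ih, ?_⟩
    funext x y z w v; simp [K, zeroP]

lemma R_collapse {k : ℕ} (h : ∀ A : V → V → V → V → V → ℝ, R (k+1) A → R k A) (l : ℕ) :
    ∀ A : V → V → V → V → V → ℝ, R l A → R k A := by
  induction l with
  | zero => intro A hA; exact R_mono (Nat.zero_le _) hA
  | succ l ih =>
    intro A hA
    obtain ⟨B, p, hB, rfl⟩ := R_succ.1 hA
    exact h _ (R_succ.2 ⟨B, p, ih B hB, rfl⟩)

lemma R_fintype {ι : Type*} [Fintype ι] (τ : ι → P V) : R (Fintype.card ι) (∑ i, K (τ i)) := by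
  refine ⟨fun i => τ ((Fintype.equivFin ι).symm i), ?_⟩
  exact (Equiv.sum_comp (Fintype.equivFin ι).symm (fun i => K (τ i))).symm

/-- Index set. -/
abbrev S (n : ℕ) : Type := {s : Fin (n+1) × Fin (n+1) × Fin (n+1) × Fin (n+1) //
  0 < s.1 ∧ s.1 ≤ s.2.1 ∧ s.2.2.1 ≤ s.2.2.2 ∧ s.2.2.1 < s.2.1}


lemma card_aux (m k : ℕ) (hk : k ≤ m) :
    (24 * ∑ z ∈ Finset.range k, (z * ∑ w ∈ Finset.range z, (m - w) : ℕ) : ℤ)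
      = k * (k - 1) * (2 * (2 * m + 1) * (2 * k - 1) - 3 * k * (k - 1)) := by
  have h1 : ∀ z ≤ m, (2 * ∑ w ∈ Finset.range z, (m - w : ℕ) : ℤ) = z * (2 * m + 1 - z) := by
    intro z
    induction z with
    | zero => simp
    | succ z ih =>
      intro hz
      rw [Finset.sum_range_succ, Nat.cast_add, mul_add, ih (by omega), Nat.cast_sub (by omega)]
      push_cast; ring
  induction k with
  | zero => simp
  | succ k ih =>
    rw [Finset.sum_range_succ, Nat.cast_add, mul_add (24:ℤ), ih (by omega)]
    have := h1 k (by omega)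
    push_cast
    push_cast at this
    linear_combination (12 * k : ℤ) * this

lemma card_S (n : ℕ) : ∑ z ∈ Finset.range (n+1), (z * ∑ w ∈ Finset.range z, (n + 1 - w))
    ≤ Fintype.card (S n) := by
  let X := Σ z : Fin (n+1), (Fin z × Σ w : Fin z, Fin (n + 1 - w))
  have hX : Fintype.card X
      = ∑ z ∈ Finset.range (n+1), (z * ∑ w ∈ Finset.range z, (n + 1 - w)) := by
    simp only [X, Fintype.card_sigma, Fintype.card_prod, Fintype.card_fin]
    rw [Finset.sum_range]
    refine Finset.sum_congr rfl fun z _ => ?_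
    rw [Finset.sum_range]
  rw [← hX]
  let φ : X → S n := fun x => ⟨(⟨x.2.1 + 1, by have := x.2.1.2; have := x.1.2; omega⟩, x.1,
    ⟨x.2.2.1, by have := x.2.2.1.2; have := x.1.2; omega⟩,
    ⟨x.2.2.1 + x.2.2.2, by have := x.2.2.1.2; have := x.1.2; have := x.2.2.2.2; omega⟩), by
      have h1 := x.2.1.2
      have h2 := x.2.2.1.2
      simp only [Fin.lt_def, Fin.le_def]
      refine ⟨?_, ?_, ?_, ?_⟩ <;> simp⟩
  refine Fintype.card_le_of_injective φ ?_
  rintro ⟨z, y, w, v⟩ ⟨z', y', w', v'⟩ h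
  have h := congrArg Subtype.val h
  simp only [φ, Prod.mk.injEq, Fin.mk.injEq] at h
  obtain ⟨h1, h2, h3, h4⟩ := h
  subst h2
  have : w = w' := Fin.ext h3
  subst this
  have : y = y' := Fin.ext (by omega)
  subst this
  have : v = v' := Fin.ext (by omega)
  subst this
  rfl

lemma count (n ν : ℕ) (h : 2 * (ν + 1) ≤ n + 1) :
    ν * (((n+1)+1).choose 2 + ((n+1)+2).choose 3) < Fintype.card (S n) := by
  refine lt_of_lt_of_le ?_ (card_S n)
  have h1 := card_aux (n+1) (n+1) le_rfl
  have h2 : (((n+1)+1).choose 2 * 2 : ℤ) = (n+2) * (n+1) := by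
    have := Nat.add_one_mul_choose_eq (n+1) 1
    simp at this
    push_cast [← @Nat.cast_inj ℤ] at this
    linarith
  have h3 : (((n+1)+2).choose 3 * 6 : ℤ) = (n+3) * (n+2) * (n+1) := by
    have := Nat.add_one_mul_choose_eq (n+2) 2
    push_cast [← @Nat.cast_inj ℤ] at this
    have e : n + 1 + 1 = n + 2 := rfl
    rw [e] at h2
    have e : n + 1 + 2 = n + 2 + 1 := rfl
    rw [e]
    linear_combination -2 * this + (n+3) * h2
  zify
  push_cast at h1
  have hν : (2 * ν : ℤ) ≤ n - 1 := by omega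
  have hn : (1:ℤ) ≤ n := by omega
  generalize (((n+1)+1).choose 2 : ℤ) = a at *
  generalize (((n+1)+2).choose 3 : ℤ) = c at *
  have hac : 6 * (a + c) = (n+1)*(n+2)*(n+6) := by linear_combination 3 * h2 + h3
  have h4 : (2 * ν) * (6 * (a + c)) ≤ (n - 1) * ((n+1)*(n+2)*(n+6) : ℤ) := by
    rw [hac]; gcongr
  have h5 : 2 * ((n - 1) * ((n+1)*(n+2)*(n+6) : ℤ)) <
     ((n+1:ℤ)) * (n+1 - 1) * (2 * (2 * (n+1) + 1) * (2 * (n+1) - 1) - 3 * (n+1) * (n+1 - 1)) := by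
    have : 0 < (n+1:ℤ)*(n+2)*(3*n^2-7*n+12) := by
      have : 0 < (3*n^2-7*n+12 : ℤ) := by nlinarith [sq_nonneg (n-1:ℤ)]
      positivity
    linarith
  linarith

/-- Symmetric forms from coefficients. -/
noncomputable def mkB {n : ℕ} (b : Module.Basis (Fin (n+1)) ℝ V)
    (β : Fin (n+1) → Fin (n+1) → ℝ) : Bil V :=
  b.constr ℝ fun i => b.constr ℝ fun j => β i j

noncomputable def mkT {n : ℕ} (b : Module.Basis (Fin (n+1)) ℝ V)
    (γ : Fin (n+1) → Fin (n+1) → Fin (n+1) → ℝ) : Tri V :=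
  b.constr ℝ fun i => b.constr ℝ fun j => b.constr ℝ fun k => γ i j k

noncomputable def mkP {n : ℕ} (b : Module.Basis (Fin (n+1)) ℝ V)
    (β : Fin (n+1) → Fin (n+1) → ℝ) (hβ : ∀ i j, β i j = β j i)
    (γ : Fin (n+1) → Fin (n+1) → Fin (n+1) → ℝ) (h1 : ∀ i j k, γ i j k = γ j i k)
    (h2 : ∀ i j k, γ i j k = γ i k j) : P V where
  f := mkB b β
  g := mkT b γ
  hf := by
    have : mkB b β = (mkB b β).flip := by
      refine b.ext fun i => b.ext fun j => ?_
      simp [mkB, hβ i j]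
    intro x y
    exact congrArg (fun F => F x y) this
  hg1 := by
    have : mkT b γ = (mkT b γ).flip := by
      refine b.ext fun i => b.ext fun j => b.ext fun k => ?_
      simp [mkT, h1 i j k]
    intro x y z
    exact congrArg (fun F => F x y z) this
  hg2 := by
    have : mkT b γ = LinearMap.lflip.comp (mkT b γ) := by
      refine b.ext fun i => b.ext fun j => b.ext fun k => ?_
      simp [mkT, h2 i j k]
    intro x y z
    exact congrArg (fun F => F x y z) this

def bt {n : ℕ} (t : S n) (i j : Fin (n+1)) : ℝ :=
  if s(i, j) = s(t.1.1, t.1.2.1) then 1 else 0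

def gt {n : ℕ} (t : S n) (i j k : Fin (n+1)) : ℝ :=
  if ({i, j, k} : Multiset (Fin (n+1))) = {0, t.1.2.2.1, t.1.2.2.2} then 1 else 0

noncomputable def pt {n : ℕ} (b : Module.Basis (Fin (n+1)) ℝ V) (t : S n) : P V :=
  mkP b (bt t) (by intro i j; simp only [bt, Sym2.eq_swap])
    (gt t) (by
      intro i j k
      have : ({i, j, k} : Multiset (Fin (n+1))) = {j, i, k} := Multiset.cons_swap _ _ _
      simp only [gt, this])
    (by
      intro i j k
      have : ({i, j, k} : Multiset (Fin (n+1))) = {i, k, j} := by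
        exact congrArg (Multiset.cons i) (Multiset.pair_comm j k)
      simp only [gt, this])

/-- Component. -/
noncomputable def comp {n : ℕ} (b : Module.Basis (Fin (n+1)) ℝ V) (s : S n) (A : V → V → V → V → V → ℝ) : ℝ :=
  A (b 0) (b s.1.1) (b s.1.2.1) (b s.1.2.2.1) (b s.1.2.2.2)

def bad {n : ℕ} (s : S n) : Prop := 0 < s.1.2.2.1 ∧ s.1.2.2.2 < s.1.1
instance {n : ℕ} (s : S n) : Decidable (bad s) := by unfold bad; infer_instance

def sg {n : ℕ} (s : S n) (h : bad s) : S n :=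
  ⟨(s.1.2.2.1, s.1.1, s.1.2.2.2, s.1.2.1), by
    obtain ⟨h1, h2, h3, h4⟩ := s.2
    obtain ⟨h5, h6⟩ := h
    exact ⟨h5, (lt_of_le_of_lt h3 h6).le, (h6.trans_le h2).le, h6⟩⟩

lemma gt0 {n : ℕ} (t : S n) (j k : Fin (n+1)) : gt t 0 j k =
    if s(j, k) = s(t.1.2.2.1, t.1.2.2.2) then 1 else 0 := by
  unfold gt
  congr 1
  simp only [Multiset.insert_eq_cons, Multiset.cons_inj_right]
  simp only [Multiset.cons_eq_cons, Sym2.eq_iff]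
  simp
  grind

lemma comp_pt {n : ℕ} (b : Module.Basis (Fin (n+1)) ℝ V) (s t : S n) :
    comp b s (K (pt b t)) = (if t = s then 1 else 0)
      - (if h : bad s then (if t = sg s h then 1 else 0) else 0) := by
  have e : comp b s (K (pt b t)) = gt t 0 s.1.2.2.1 s.1.2.2.2 * bt t s.1.1 s.1.2.1
    + bt t 0 s.1.2.2.1 * gt t s.1.1 s.1.2.1 s.1.2.2.2
    - gt t 0 s.1.2.1 s.1.2.2.2 * bt t s.1.1 s.1.2.2.1
    - bt t 0 s.1.2.1 * gt t s.1.1 s.1.2.2.1 s.1.2.2.2 := by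
      simp [comp, K, pt, mkP, mkB, mkT]
  have z : ∀ i, bt t 0 i = 0 := by
    intro i
    have h1 := t.2.1
    have h2 := t.2.2.1
    unfold bt
    rw [if_neg]
    rw [Sym2.eq_iff]
    rintro (⟨h, _⟩ | ⟨h, _⟩)
    · rw [← h] at h1; exact lt_irrefl _ h1
    · rw [← h] at h2; exact lt_irrefl _ (lt_of_lt_of_le h1 h2)
  rw [e, z, z, gt0, gt0]
  simp only [zero_mul, add_zero, sub_zero, bt]
  obtain ⟨h1, h2, h3, h4⟩ := s.2
  obtain ⟨h1', h2', h3', h4'⟩ := t.2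
  have e1 : t = s ↔ (t.1.1 = s.1.1 ∧ t.1.2.1 = s.1.2.1 ∧ t.1.2.2.1 = s.1.2.2.1 ∧
      t.1.2.2.2 = s.1.2.2.2) :=
    ⟨by rintro rfl; simp, fun h => Subtype.ext (Prod.ext h.1 (Prod.ext h.2.1
      (Prod.ext h.2.2.1 h.2.2.2)))⟩
  have e2 : ∀ h, t = sg s h ↔ (t.1.1 = s.1.2.2.1 ∧ t.1.2.1 = s.1.1 ∧ t.1.2.2.1 = s.1.2.2.2 ∧
      t.1.2.2.2 = s.1.2.1) := fun hb =>
    ⟨by rintro rfl; simp [sg], fun h => Subtype.ext (Prod.ext h.1 (Prod.ext h.2.1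
      (Prod.ext h.2.2.1 h.2.2.2)))⟩
  simp only [e1, e2, Sym2.eq_iff]
  clear e e1 e2 z
  congr 1
  · rw [ite_zero_mul_ite_zero, mul_one]
    congr 1
    simp only [eq_iff_iff]
    constructor
    · rintro ⟨h | h, h' | h'⟩ <;> simp only [Fin.lt_def, Fin.le_def, Fin.ext_iff] at * <;> omega
    · simp only [Fin.lt_def, Fin.le_def, Fin.ext_iff] at *; omega
  · rw [ite_zero_mul_ite_zero, mul_one]
    by_cases hb : bad s
    · rw [dif_pos hb]
      unfold bad at hb
      congr 1
      simp only [eq_iff_iff]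
      simp only [Fin.lt_def, Fin.le_def, Fin.ext_iff] at *; omega
    · rw [dif_neg hb, if_neg]
      unfold bad at hb
      simp only [Fin.lt_def, Fin.le_def, Fin.ext_iff, Fin.val_zero] at *; omega

lemma exists_comp {n : ℕ} (b : Module.Basis (Fin (n+1)) ℝ V) (g : S n → ℝ) :
    ∃ A : V → V → V → V → V → ℝ, (∃ k, R k A) ∧ ∀ s, comp b s A = g s := by
  let c : S n → ℝ := fun s => g s + if h : bad s then g (sg s h) else 0
  refine ⟨∑ t, K (smulP (c t) (pt b t)), ⟨_, R_fintype _⟩, fun s => ?_⟩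
  have e : comp b s (∑ t, K (smulP (c t) (pt b t))) = ∑ t, c t * comp b s (K (pt b t)) := by
    simp only [comp, Finset.sum_apply, K_smul]
  rw [e]
  simp only [comp_pt]
  by_cases hb : bad s
  · have hn : ¬ bad (sg s hb) := by
      rintro ⟨h5, h6⟩
      exact lt_asymm h6 s.2.2.2.2
    simp [hb, mul_sub, Finset.sum_sub_distrib, c, hn]
  · simp [hb, c]

abbrev E (n ν : ℕ) := Fin ν → (Sym2 (Fin (n+1)) → ℝ) × (Sym (Fin (n+1)) 3 → ℝ)

def tri {n : ℕ} (i j k : Fin (n+1)) : Sym (Fin (n+1)) 3 := ⟨{i, j, k}, rfl⟩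

noncomputable def F (n ν : ℕ) (p : E n ν) : S n → ℝ := fun s =>
  ∑ j, ((p j).2 (tri 0 s.1.2.2.1 s.1.2.2.2) * (p j).1 s(s.1.1, s.1.2.1)
    + (p j).1 s(0, s.1.2.2.1) * (p j).2 (tri s.1.1 s.1.2.1 s.1.2.2.2)
    - (p j).2 (tri 0 s.1.2.1 s.1.2.2.2) * (p j).1 s(s.1.1, s.1.2.2.1)
    - (p j).1 s(0, s.1.2.1) * (p j).2 (tri s.1.1 s.1.2.2.1 s.1.2.2.2))

lemma F_smooth (n ν : ℕ) : ContDiff ℝ 1 (F n ν) := by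
  have h1 : ∀ j a, ContDiff ℝ 1 (fun p : E n ν => (p j).1 a) := by
    intro j a; fun_prop
  have h2 : ∀ j a, ContDiff ℝ 1 (fun p : E n ν => (p j).2 a) := by
    intro j a; fun_prop
  refine contDiff_pi.2 fun s => ContDiff.sum fun j _ => ?_
  exact ((((h2 _ _).mul (h1 _ _)).add ((h1 _ _).mul (h2 _ _))).sub ((h2 _ _).mul (h1 _ _))).sub
    ((h1 _ _).mul (h2 _ _))

lemma F_not_surj (n ν : ℕ) (h : 2 * (ν + 1) ≤ n + 1) : ∃ g, g ∉ Set.range (F n ν) := by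
  have hd : Module.finrank ℝ (E n ν) < Module.finrank ℝ (S n → ℝ) := by
    have := count n ν h
    rw [Module.finrank_pi]
    refine lt_of_eq_of_lt ?_ this
    simp [Module.finrank_pi_fintype, Module.finrank_prod, Sym2.card, Sym.card_sym_eq_choose]
  exact (ContDiff.dense_compl_range_of_finrank_lt_finrank (F_smooth n ν) hd).nonempty

lemma rep_mem {n ν : ℕ} (b : Module.Basis (Fin (n+1)) ℝ V) {A : V → V → V → V → V → ℝ}
    (hA : R ν A) : (fun s => comp b s A) ∈ Set.range (F n ν) := by
  obtain ⟨τ, rfl⟩ := hA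
  have hB : ∀ p : P V, ∃ q : Sym2 (Fin (n+1)) → ℝ, ∀ i j, q s(i, j) = p.f (b i) (b j) := by
    intro p
    exact ⟨Sym2.lift ⟨fun i j => p.f (b i) (b j), fun i j => p.hf _ _⟩, fun i j => rfl⟩
  have hT : ∀ p : P V, ∃ q : Sym (Fin (n+1)) 3 → ℝ,
      ∀ i j k, q (tri i j k) = p.g (b i) (b j) (b k) := by
    intro p
    let u : Fin (n+1) × Fin (n+1) × Fin (n+1) → Sym (Fin (n+1)) 3 := fun a => tri a.1 a.2.1 a.2.2
    let w : Fin (n+1) × Fin (n+1) × Fin (n+1) → ℝ := fun a => p.g (b a.1) (b a.2.1) (b a.2.2)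
    have hf : Function.FactorsThrough w u := by
      rintro ⟨i, j, k⟩ ⟨i', j', k'⟩ h
      have h := congrArg Subtype.val h
      simp only [u, tri, Multiset.insert_eq_cons, Multiset.cons_eq_cons] at h
      simp only [w]
      have h1 := p.hg1
      have h2 := p.hg2
      have h3 : ∀ a c : Fin (n+1), ({a} : Multiset (Fin (n+1))) = {c} → a = c :=
        fun a c => Multiset.singleton_inj.1
      simp at h
      rcases h with ⟨rfl, h⟩ | ⟨_, cs, h, h'⟩
      · grind
      · rcases h with ⟨ha, hb⟩ | ⟨_, ha, hb⟩ <;> rcases h' with ⟨ha', hb'⟩ | ⟨_, ha', hb'⟩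
        · have := h3 _ _ (hb.trans hb'.symm); grind
        · have := h3 _ _ (hb.trans hb'); grind
        · have := h3 _ _ (hb.symm.trans hb'.symm); grind
        · have := h3 _ _ (hb.symm.trans hb'); grind
    exact ⟨Function.extend u w 0, fun i j k => hf.extend_apply 0 (i, j, k)⟩
  choose q1 hq1 using hB
  choose q2 hq2 using hT
  refine ⟨fun j => (q1 (τ j), q2 (τ j)), ?_⟩
  funext s
  simp only [F, comp, Finset.sum_apply, K, hq1, hq2]

lemma key {n ν : ℕ} (b : Module.Basis (Fin (n+1)) ℝ V) (h : 2 * (ν + 1) ≤ n + 1) :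
    ∃ A : V → V → V → V → V → ℝ, R (ν+1) A ∧ ¬ R ν A := by
  by_contra! hc
  obtain ⟨g, hg⟩ := F_not_surj n ν h
  obtain ⟨A, ⟨k, hk⟩, hA⟩ := exists_comp b g
  apply hg
  have := rep_mem b (R_collapse hc k A hk)
  rwa [funext hA] at this

end
end S13

/-- If dim V = m with m = 2mb or m = 2mb+1, there is an algebraic
covariant derivative curvature tensor A₁ (a sum of mb tensors A_{1,Ψᵢ,Ψ_{1,i}})
such that every representation A₁ = Σ_{j=1}^{ν₁} λⱼ A_{1,Φⱼ,Φ_{1,j}} requires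
ν₁ ≥ mb; hence ν₁(m) ≥ m/2. -/
theorem stmt13 (V : Type*) [NormedAddCommGroup V] [InnerProductSpace ℝ V]
    [FiniteDimensional ℝ V] (m mb : ℕ)
    (hdim : Module.finrank ℝ V = m) (hm : m = 2 * mb ∨ m = 2 * mb + 1) :
    ∃ A₁ : V → V → V → V → V → ℝ,
      (∃ (Ψ : Fin mb → V →ₗ[ℝ] V →ₗ[ℝ] ℝ)
         (Ψ₁ : Fin mb → V →ₗ[ℝ] V →ₗ[ℝ] V →ₗ[ℝ] ℝ),
        (∀ i x y, Ψ i x y = Ψ i y x) ∧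
        (∀ i x y z, Ψ₁ i x y z = Ψ₁ i y x z) ∧
        (∀ i x y z, Ψ₁ i x y z = Ψ₁ i x z y) ∧
        ∀ x y z w v, A₁ x y z w v =
          ∑ i, (Ψ₁ i x w v * Ψ i y z + Ψ i x w * Ψ₁ i y z v
            - Ψ₁ i x z v * Ψ i y w - Ψ i x z * Ψ₁ i y w v)) ∧
      ∀ (ν₁ : ℕ) (lam : Fin ν₁ → ℝ) (Φ : Fin ν₁ → V →ₗ[ℝ] V →ₗ[ℝ] ℝ)
        (Φ₁ : Fin ν₁ → V →ₗ[ℝ] V →ₗ[ℝ] V →ₗ[ℝ] ℝ),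
        (∀ j x y, Φ j x y = Φ j y x) →
        (∀ j x y z, Φ₁ j x y z = Φ₁ j y x z) →
        (∀ j x y z, Φ₁ j x y z = Φ₁ j x z y) →
        (∀ x y z w v, A₁ x y z w v =
          ∑ j, lam j * (Φ₁ j x w v * Φ j y z + Φ j x w * Φ₁ j y z v
            - Φ₁ j x z v * Φ j y w - Φ j x z * Φ₁ j y w v)) →
        mb ≤ ν₁ := by
  rcases mb with _ | ν
  · refine ⟨0, ⟨fun _ => 0, fun _ => 0, by simp, by simp, by simp, by simp⟩, ?_⟩
    intros; exact Nat.zero_le _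
  obtain ⟨n, rfl⟩ : ∃ n, m = n + 1 := ⟨m - 1, by omega⟩
  obtain ⟨A, ⟨τ, hτ⟩, hA⟩ := S13.key (ν := ν) (Module.finBasisOfFinrankEq ℝ V hdim) (by omega)
  refine ⟨A, ⟨fun i => (τ i).f, fun i => (τ i).g, fun i => (τ i).hf, fun i => (τ i).hg1,
    fun i => (τ i).hg2, ?_⟩, ?_⟩
  · intro x y z w v
    rw [hτ]
    simp only [Finset.sum_apply, S13.K]
  · intro ν₁ lam Φ Φ₁ h1 h2 h3 h4
    by_contra hlt
    apply hA
    refine S13.R_mono (k := ν₁) (by omega)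
      ⟨fun j => S13.smulP (lam j) ⟨Φ j, Φ₁ j, h1 j, h2 j, h3 j⟩, ?_⟩
    funext x y z w v
    rw [h4]
    simp only [Finset.sum_apply, S13.K_smul]
    rfl
end
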